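/- In the composition of linear Lagrangian correspondences: with the notation above, if moreover the projection L₁₂ ×_{V₂} L₂₃ → V₁ × V₃ has image L₁₂ ∘ L₂₃ of dimension (1/2)(dim V₁ + dim V₃), then L₁₂ ∘ L₂₃ is Lagrangian in (V₁ × V₃, ω₁ ⊖ ω₃). -/

import Mathlib

/-- The difference symplectic form `π₁*ω - π₂*η` on a product `V × W`. -/
noncomputable def prodDiffForm {k V W : Type*} [Field k]
    [AddCommGroup V] [Module k V] [AddCommGroup W] [Module k W]
    (ω : LinearMap.BilinForm k V) (η : LinearMap.BilinForm k W) :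
    LinearMap.BilinForm k (V × W) :=
  ω.compl₁₂ (LinearMap.fst k V W) (LinearMap.fst k V W) -
    η.compl₁₂ (LinearMap.snd k V W) (LinearMap.snd k V W)

/-- The set-theoretic composition `L₁₂ ∘ L₂₃ ⊆ V₁ × V₃`, as the image in `V₁ × V₃`
of the fiber product `L₁₂ ×_{V₂} L₂₃`. -/
def lagComp {k V₁ V₂ V₃ : Type*} [Field k]
    [AddCommGroup V₁] [Module k V₁] [AddCommGroup V₂] [Module k V₂]
    [AddCommGroup V₃] [Module k V₃]
    (L₁₂ : Submodule k (V₁ × V₂)) (L₂₃ : Submodule k (V₂ × V₃)) :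
    Submodule k (V₁ × V₃) :=
  Submodule.map
    (LinearMap.prod
      ((LinearMap.fst k V₁ V₂).comp (LinearMap.fst k (V₁ × V₂) (V₂ × V₃)))
      ((LinearMap.snd k V₂ V₃).comp (LinearMap.snd k (V₁ × V₂) (V₂ × V₃))))
    ((L₁₂.prod L₂₃) ⊓
      LinearMap.ker
        (((LinearMap.snd k V₁ V₂).comp (LinearMap.fst k (V₁ × V₂) (V₂ × V₃))) -
          ((LinearMap.fst k V₂ V₃).comp (LinearMap.snd k (V₁ × V₂) (V₂ × V₃)))))

@[simp]
theorem prodDiffForm_apply {k V W : Type*} [Field k]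
    [AddCommGroup V] [Module k V] [AddCommGroup W] [Module k W]
    (ω : LinearMap.BilinForm k V) (η : LinearMap.BilinForm k W) (x y : V × W) :
    prodDiffForm ω η x y = ω x.1 y.1 - η x.2 y.2 := rfl

theorem prodDiffForm_nondegenerate {k V W : Type*} [Field k]
    [AddCommGroup V] [Module k V] [AddCommGroup W] [Module k W]
    {ω : LinearMap.BilinForm k V} {η : LinearMap.BilinForm k W}
    (hω : ω.Nondegenerate) (hη : η.Nondegenerate) : (prodDiffForm ω η).Nondegenerate := by
  constructor
  · intro x hx
    exact Prod.ext (hω.1 _ fun y => by simpa using hx (y, 0))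
      (hη.1 _ fun y => by simpa using hx (0, y))
  · intro x hx
    exact Prod.ext (hω.2 _ fun y => by simpa using hx (y, 0))
      (hη.2 _ fun y => by simpa using hx (0, y))

theorem mem_lagComp {k V₁ V₂ V₃ : Type*} [Field k]
    [AddCommGroup V₁] [Module k V₁] [AddCommGroup V₂] [Module k V₂]
    [AddCommGroup V₃] [Module k V₃]
    {L₁₂ : Submodule k (V₁ × V₂)} {L₂₃ : Submodule k (V₂ × V₃)} {p : V₁ × V₃} :
    p ∈ lagComp L₁₂ L₂₃ ↔ ∃ v, (p.1, v) ∈ L₁₂ ∧ (v, p.2) ∈ L₂₃ := by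
  constructor
  · rintro ⟨⟨⟨a, b⟩, c, d⟩, ⟨⟨hab, hcd⟩, hbc⟩, rfl⟩
    obtain rfl : b = c := by simpa [sub_eq_zero] using hbc
    exact ⟨b, hab, hcd⟩
  · rintro ⟨v, h₁, h₂⟩
    exact ⟨((p.1, v), (v, p.2)), ⟨⟨h₁, h₂⟩, by simp⟩, rfl⟩

/-- The composition of isotropic correspondences is isotropic. -/
theorem lagComp_le_orthogonal {k V₁ V₂ V₃ : Type*} [Field k]
    [AddCommGroup V₁] [Module k V₁] [AddCommGroup V₂] [Module k V₂]
    [AddCommGroup V₃] [Module k V₃]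
    {ω₁ : LinearMap.BilinForm k V₁} {ω₂ : LinearMap.BilinForm k V₂}
    {ω₃ : LinearMap.BilinForm k V₃}
    {L₁₂ : Submodule k (V₁ × V₂)} {L₂₃ : Submodule k (V₂ × V₃)}
    (hL₁₂ : L₁₂ ≤ (prodDiffForm ω₁ ω₂).orthogonal L₁₂)
    (hL₂₃ : L₂₃ ≤ (prodDiffForm ω₂ ω₃).orthogonal L₂₃) :
    lagComp L₁₂ L₂₃ ≤ (prodDiffForm ω₁ ω₃).orthogonal (lagComp L₁₂ L₂₃) := by
  intro p hp q hq
  obtain ⟨v, hv₁, hv₂⟩ := mem_lagComp.1 hp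
  obtain ⟨w, hw₁, hw₂⟩ := mem_lagComp.1 hq
  have h₁ : ω₁ q.1 p.1 - ω₂ w v = 0 := hL₁₂ hv₁ _ hw₁
  have h₂ : ω₂ w v - ω₃ q.2 p.2 = 0 := hL₂₃ hv₂ _ hw₂
  change ω₁ q.1 p.1 - ω₃ q.2 p.2 = 0
  rw [← sub_add_sub_cancel _ (ω₂ w v), h₁, h₂, add_zero]

/-- if moreover the composition `L₁₂ ∘ L₂₃` (the image of the projection
`L₁₂ ×_{V₂} L₂₃ → V₁ × V₃`) has dimension `(1/2)(dim V₁ + dim V₃)`, then it is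
Lagrangian in `(V₁ × V₃, ω₁ ⊖ ω₃)`. -/
theorem statement_9 {k V₁ V₂ V₃ : Type*} [Field k]
    [AddCommGroup V₁] [Module k V₁] [FiniteDimensional k V₁]
    [AddCommGroup V₂] [Module k V₂] [FiniteDimensional k V₂]
    [AddCommGroup V₃] [Module k V₃] [FiniteDimensional k V₃]
    (ω₁ : LinearMap.BilinForm k V₁) (h₁a : ω₁.IsAlt) (h₁n : ω₁.Nondegenerate)
    (ω₂ : LinearMap.BilinForm k V₂) (h₂a : ω₂.IsAlt) (h₂n : ω₂.Nondegenerate)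
    (ω₃ : LinearMap.BilinForm k V₃) (h₃a : ω₃.IsAlt) (h₃n : ω₃.Nondegenerate)
    (L₁₂ : Submodule k (V₁ × V₂)) (L₂₃ : Submodule k (V₂ × V₃))
    (hL₁₂ : L₁₂ = (prodDiffForm ω₁ ω₂).orthogonal L₁₂)
    (hL₂₃ : L₂₃ = (prodDiffForm ω₂ ω₃).orthogonal L₂₃)
    (hdim : 2 * Module.finrank k (lagComp L₁₂ L₂₃) =
      Module.finrank k V₁ + Module.finrank k V₃) :
    lagComp L₁₂ L₂₃ = (prodDiffForm ω₁ ω₃).orthogonal (lagComp L₁₂ L₂₃) := by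
  refine Submodule.eq_of_le_of_finrank_le (lagComp_le_orthogonal hL₁₂.le hL₂₃.le) ?_
  rw [LinearMap.BilinForm.finrank_orthogonal (prodDiffForm_nondegenerate h₁n h₃n),
    Module.finrank_prod]
  lia
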